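/- If y is a client and x_i ∈ F_MP with D(x_i, y) ≤ r_i, then charge(y, F_MP) = r_i. -/

import Mathlib

open scoped Classical

/-- `Dmin D F y` is the distance from client `y` to the nearest facility of `F`. -/
noncomputable def Dmin {nf nc : ℕ} (D : Fin nf → Fin nc → ℝ)
    (F : Finset (Fin nf)) (y : Fin nc) : ℝ :=
  if h : F.Nonempty then F.inf' h (fun x => D x y) else 0

/-- `charge y F = D(F,y) + Σ_{x ∈ F} max {0, r_x − D(x,y)}`. -/
noncomputable def charge {nf nc : ℕ} (D : Fin nf → Fin nc → ℝ) (r : Fin nf → ℝ)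
    (y : Fin nc) (F : Finset (Fin nf)) : ℝ :=
  Dmin D F y + ∑ x ∈ F, max 0 (r x - D x y)

/-- Facility-facility distance: `D(x,x') = min_y (D(x,y) + D(x',y))`. -/
noncomputable def Dff {nf nc : ℕ} (D : Fin nf → Fin nc → ℝ)
    (x x' : Fin nf) : ℝ :=
  ⨅ y : Fin nc, (D x y + D x' y)

theorem Dff_le {nf nc : ℕ} {D : Fin nf → Fin nc → ℝ} (x x' : Fin nf) (y : Fin nc) :
    Dff D x x' ≤ D x y + D x' y :=
  ciInf_le (Set.finite_range _).bddBelow y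

theorem Dmin_eq_of_forall_le {nf nc : ℕ} {D : Fin nf → Fin nc → ℝ} {F : Finset (Fin nf)}
    {y : Fin nc} {x : Fin nf} (hx : x ∈ F) (hle : ∀ x' ∈ F, D x y ≤ D x' y) :
    Dmin D F y = D x y := by
  rw [Dmin, dif_pos ⟨x, hx⟩]
  exact le_antisymm (Finset.inf'_le _ hx) (Finset.le_inf' _ _ hle)

/-- A client in the ball of one facility lies outside the ball of any facility separated from it,
at distance exceeding both radii. -/
theorem max_lt_of_separated {nf nc : ℕ} {D : Fin nf → Fin nc → ℝ} {r : Fin nf → ℝ}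
    {y : Fin nc} {x x' : Fin nf} (hsep : Dff D x x' > 2 * max (r x) (r x'))
    (hnear : D x y ≤ r x) : max (r x) (r x') < D x' y := by
  linarith [Dff_le (D := D) x x' y, le_max_left (r x) (r x')]

/-- If the facilities of `F_MP` are pairwise separated by more than twice the max of
their radii, and `y` lies in the ball of `x_i ∈ F_MP`, then `charge(y, F_MP) = r_i`. -/
theorem stmt4 (nf nc : ℕ) (hnc : 0 < nc)
    (D : Fin nf → Fin nc → ℝ) (hD : ∀ x y, 0 ≤ D x y)
    (r : Fin nf → ℝ) (hr : ∀ x, 0 ≤ r x)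
    (FMP : Finset (Fin nf))
    (hsep : ∀ x ∈ FMP, ∀ x' ∈ FMP, x ≠ x' → Dff D x x' > 2 * max (r x) (r x'))
    (y : Fin nc) (xi : Fin nf) (hxi : xi ∈ FMP) (hnear : D xi y ≤ r xi) :
    charge D r y FMP = r xi := by
  have hfar : ∀ x ∈ FMP, x ≠ xi → max (r xi) (r x) < D x y := fun x hx hne =>
    max_lt_of_separated (hsep xi hxi x hx hne.symm) hnear
  have hmin : Dmin D FMP y = D xi y := by
    refine Dmin_eq_of_forall_le hxi fun x hx => ?_
    rcases eq_or_ne x xi with rfl | hne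
    · exact le_rfl
    · exact hnear.trans ((le_max_left _ _).trans (hfar x hx hne).le)
  have hsum : ∑ x ∈ FMP, max 0 (r x - D x y) = r xi - D xi y := by
    rw [Finset.sum_eq_single_of_mem xi hxi, max_eq_right (sub_nonneg.2 hnear)]
    exact fun x hx hne =>
      max_eq_left (sub_nonpos.2 ((le_max_right _ _).trans (hfar x hx hne).le))
  rw [charge, hmin, hsum, add_sub_cancel]
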